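/- arXiv:2107.06837 — 2 statements merged into one kernel-verified Lean document; each statement's English description precedes it below -/
import Mathlib

section
/- Let n be an odd positive integer and let (a_1,…,a_n) be an open meandric permutation of order n. Then the sequence of length 2n+32 consisting of (21, 20, 1, 4, 17, 24, 25, 16, 5, 8, 13, 30, 31, 12, 9), followed by the block of length n whose j-th entry (1 ≤ j ≤ n) equals 32+2a_j if j is odd and 32+2a_j−1 if j is even, followed by (27, 28), followed by the block of length n whose j-th entry (1 ≤ j ≤ n) equals 32+2a_{n+1−j}−1 if j is odd and 32+2a_{n+1−j} if j is even, followed by (10, 11, 32, 29, 14, 7, 6, 15, 26, 23, 18, 3, 2, 19, 22), is an irreducible open meandric permutation of order 2n+32. -/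
open Filter

/-- `x` lies strictly between `p` and `q`. -/
def StrictlyBetween (p q x : ℕ) : Prop := min p q < x ∧ x < max p q

/-- Two arcs `{p, q}` and `{r, s}` cross if exactly one of `r`, `s` lies strictly
between `p` and `q`. -/
def ArcsCross (p q r s : ℕ) : Prop :=
  Xor' (StrictlyBetween p q r) (StrictlyBetween p q s)

/-- `a` (with one-based indexing, only the values `a 1, …, a n` being relevant)
is an open meandric permutation of order `n`: it is a permutation of `{1, …, n}`
with `a i ≡ i (mod 2)`, whose upper arcs (pairs `{a i, a (i+1)}` for odd `i < n`)
are pairwise noncrossing, whose lower arcs (pairs `{a i, a (i+1)}` for even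
`1 ≤ i < n`) are pairwise noncrossing, such that no lower arc strictly encloses
`a 1`, and no lower arc (if `n` is even) resp. upper arc (if `n` is odd)
strictly encloses `a n`. -/
def IsOpenMeandricPerm (n : ℕ) (a : ℕ → ℕ) : Prop :=
  1 ≤ n ∧
  (∀ i, 1 ≤ i → i ≤ n → 1 ≤ a i ∧ a i ≤ n) ∧
  (∀ i j, 1 ≤ i → i ≤ n → 1 ≤ j → j ≤ n → a i = a j → i = j) ∧
  (∀ i, 1 ≤ i → i ≤ n → a i % 2 = i % 2) ∧
  (∀ i j, Odd i → i < n → Odd j → j < n →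
      ¬ ArcsCross (a i) (a (i + 1)) (a j) (a (j + 1))) ∧
  (∀ i j, Even i → 1 ≤ i → i < n → Even j → 1 ≤ j → j < n →
      ¬ ArcsCross (a i) (a (i + 1)) (a j) (a (j + 1))) ∧
  (∀ i, Even i → 1 ≤ i → i < n → ¬ StrictlyBetween (a i) (a (i + 1)) (a 1)) ∧
  (if Even n
    then ∀ i, Even i → 1 ≤ i → i < n → ¬ StrictlyBetween (a i) (a (i + 1)) (a n)
    else ∀ i, Odd i → i < n → ¬ StrictlyBetween (a i) (a (i + 1)) (a n))

/-- An open meandric permutation of order `n` is irreducible if there are no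
indices `1 ≤ k₁ < k₂ ≤ n` with `2 < k₂ - k₁ ≤ n - 2` such that the values
`a k₁, …, a k₂` form an interval of integers, i.e. their max minus their min
equals `k₂ - k₁`. -/
def IsIrreducibleMeander (n : ℕ) (a : ℕ → ℕ) : Prop :=
  ¬ ∃ k₁ k₂ : ℕ, ∃ h : k₁ < k₂, 1 ≤ k₁ ∧ k₂ ≤ n ∧ 2 < k₂ - k₁ ∧ k₂ - k₁ ≤ n - 2 ∧
    (Finset.Icc k₁ k₂).sup' (Finset.nonempty_Icc.mpr h.le) a -
      (Finset.Icc k₁ k₂).inf' (Finset.nonempty_Icc.mpr h.le) a = k₂ - k₁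

/-- An open meandric permutation of order `n` is prime if `a 1 ≠ 1` and no proper
initial segment `a 1, …, a j` (`2 ≤ j < n`) is a permutation of `{1, …, j}`. -/
def IsPrimeMeander (n : ℕ) (a : ℕ → ℕ) : Prop :=
  a 1 ≠ 1 ∧ ¬ ∃ j, 2 ≤ j ∧ j < n ∧ (Finset.Icc 1 j).image a = Finset.Icc 1 j

/-- `a` (with one-based indexing) is a closed meandric permutation of order `n`:
a permutation of `{1, …, 2n}` with `a 1 = 1`, `a i ≡ i (mod 2)`, pairwise
noncrossing upper arcs `{a i, a (i+1)}` (odd `i < 2n`) and pairwise noncrossing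
lower arcs, the latter being the `{a i, a (i+1)}` for even `1 ≤ i < 2n` together
with the wrap-around arc `{a (2n), a 1}`. -/
def IsClosedMeandricPerm (n : ℕ) (a : ℕ → ℕ) : Prop :=
  1 ≤ n ∧ a 1 = 1 ∧
  (∀ i, 1 ≤ i → i ≤ 2 * n → 1 ≤ a i ∧ a i ≤ 2 * n) ∧
  (∀ i j, 1 ≤ i → i ≤ 2 * n → 1 ≤ j → j ≤ 2 * n → a i = a j → i = j) ∧
  (∀ i, 1 ≤ i → i ≤ 2 * n → a i % 2 = i % 2) ∧
  (∀ i j, Odd i → i < 2 * n → Odd j → j < 2 * n →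
      ¬ ArcsCross (a i) (a (i + 1)) (a j) (a (j + 1))) ∧
  (∀ i j, Even i → 1 ≤ i → i < 2 * n → Even j → 1 ≤ j → j < 2 * n →
      ¬ ArcsCross (a i) (a (i + 1)) (a j) (a (j + 1))) ∧
  (∀ i, Even i → 1 ≤ i → i < 2 * n →
      ¬ ArcsCross (a i) (a (i + 1)) (a (2 * n)) (a 1) ∧
      ¬ ArcsCross (a (2 * n)) (a 1) (a i) (a (i + 1)))

/-- `M n`: the number of open meandric permutations of order `n` (each counted
once via the normalization `a i = 0` outside `{1, …, n}`). -/
noncomputable def openMeanderCount (n : ℕ) : ℕ :=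
  Set.ncard {a : ℕ → ℕ | IsOpenMeandricPerm n a ∧ ∀ i, i < 1 ∨ n < i → a i = 0}

/-- `M^{Irr} n`: the number of irreducible open meandric permutations of order `n`. -/
noncomputable def irrMeanderCount (n : ℕ) : ℕ :=
  Set.ncard {a : ℕ → ℕ | IsOpenMeandricPerm n a ∧ IsIrreducibleMeander n a ∧
    ∀ i, i < 1 ∨ n < i → a i = 0}

/-- `M^{(P)} n`: the number of prime open meandric permutations of order `n`. -/
noncomputable def primeMeanderCount (n : ℕ) : ℕ :=
  Set.ncard {a : ℕ → ℕ | IsOpenMeandricPerm n a ∧ IsPrimeMeander n a ∧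
    ∀ i, i < 1 ∨ n < i → a i = 0}

/-- `M̄ n`: the number of closed meandric permutations of order `n`. -/
noncomputable def closedMeanderCount (n : ℕ) : ℕ :=
  Set.ncard {a : ℕ → ℕ | IsClosedMeandricPerm n a ∧ ∀ i, i < 1 ∨ 2 * n < i → a i = 0}

theorem not_arcsCross_iff {p q r s : ℕ} : ¬ ArcsCross p q r s ↔
    ((min p q < r ∧ r < max p q) ↔ (min p q < s ∧ s < max p q)) := by
  change ¬ Xor (min p q < r ∧ r < max p q) (min p q < s ∧ s < max p q) ↔ _
  rw [xor_iff_not_iff, not_not]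

theorem arcsCross_swap_left {p q r s : ℕ} : ArcsCross p q r s ↔ ArcsCross q p r s := by
  rw [← not_iff_not, not_arcsCross_iff, not_arcsCross_iff, min_comm, max_comm]

theorem arcsCross_swap_right {p q r s : ℕ} : ArcsCross p q r s ↔ ArcsCross p q s r := by
  rw [← not_iff_not, not_arcsCross_iff, not_arcsCross_iff]
  exact iff_comm

theorem not_arcsCross_of_or {P : ℕ → ℕ → Prop}
    (hP : ∀ p q r s, P p q → P r s → ¬ ArcsCross p q r s) {p q r s : ℕ}
    (h : P p q ∨ P q p) (h' : P r s ∨ P s r) : ¬ ArcsCross p q r s := by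
  rcases h with h | h <;> rcases h' with h' | h'
  · exact hP _ _ _ _ h h'
  · exact fun H => hP _ _ _ _ h h' (arcsCross_swap_right.mp H)
  · exact fun H => hP _ _ _ _ h h' (arcsCross_swap_left.mp H)
  · exact fun H => hP _ _ _ _ h h' (arcsCross_swap_left.mp (arcsCross_swap_right.mp H))

/-- The arcs on one side of a cabled meander: fixed arcs from `U` on the points `1, …, 32`, two
parallel arcs joining `s` and `s + 1` to the doubled point `e`, and two parallel copies of every
arc in `R`, the point `v` being doubled to `31 + 2 * v` and `32 + 2 * v`. -/
inductive CableArc (U : List (ℕ × ℕ)) (s e : ℕ) (R : ℕ → ℕ → Prop) : ℕ → ℕ → Prop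
  | small {p q : ℕ} (h : (p, q) ∈ U) : CableArc U s e R p q
  | outer : CableArc U s e R s (32 + 2 * e)
  | inner : CableArc U s e R (s + 1) (31 + 2 * e)
  | left {o v : ℕ} (h : R o v) : CableArc U s e R (32 + 2 * o) (31 + 2 * v)
  | right {o v : ℕ} (h : R o v) : CableArc U s e R (31 + 2 * o) (32 + 2 * v)

theorem CableArc.not_arcsCross {U : List (ℕ × ℕ)} {s e : ℕ} {R : ℕ → ℕ → Prop}
    (hs : s < 32) (he : e % 2 = 1)
    (hU : ∀ x ∈ U, x.1 ≤ 32 ∧ x.2 ≤ 32 ∧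
      ((x.1 < s ∧ x.2 < s) ∨ (s + 1 < x.1 ∧ s + 1 < x.2)))
    (hUU : ∀ x ∈ U, ∀ y ∈ U, ¬ ArcsCross x.1 x.2 y.1 y.2)
    (hR : ∀ o v, R o v → 1 ≤ o ∧ 1 ≤ v ∧ o % 2 = 1 ∧ v % 2 = 0 ∧ o ≠ e ∧
      ¬ StrictlyBetween o v e)
    (hRR : ∀ o v o' v', R o v → R o' v' → ¬ ArcsCross o v o' v' ∧ (o = o' ↔ v = v'))
    {p q p' q' : ℕ} (h : CableArc U s e R p q) (h' : CableArc U s e R p' q') :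
    ¬ ArcsCross p q p' q' := by
  have hpos : 1 ≤ e := by omega
  have hR' : ∀ o v, R o v → 1 ≤ o ∧ 1 ≤ v ∧ o % 2 = 1 ∧ v % 2 = 0 ∧ o ≠ e ∧
      ¬ (min o v < e ∧ e < max o v) := hR
  have hRR' : ∀ o v o' v', R o v → R o' v' →
      ((min o v < o' ∧ o' < max o v) ↔ (min o v < v' ∧ v' < max o v)) ∧ (o = o' ↔ v = v') := by
    intro o v o' v' h1 h2
    have := hRR o v o' v' h1 h2
    rwa [not_arcsCross_iff] at this
  clear hR hRR
  cases h with
  | small h =>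
    cases h' with
    | small h' => exact hUU _ h _ h'
    | outer | inner =>
      have := hU _ h
      rw [not_arcsCross_iff]
      omega
    | left h' | right h' =>
      have := hU _ h
      have := hR' _ _ h'
      rw [not_arcsCross_iff]
      omega
  | outer | inner =>
    cases h' with
    | small h' =>
      have := hU _ h'
      rw [not_arcsCross_iff]
      omega
    | outer | inner =>
      rw [not_arcsCross_iff]
      omega
    | left h' | right h' =>
      have := hR' _ _ h'
      rw [not_arcsCross_iff]
      omega
  | left h | right h =>
    have h1 := hR' _ _ h
    cases h' with
    | small h' =>
      have := hU _ h'
      rw [not_arcsCross_iff]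
      omega
    | outer | inner =>
      rw [not_arcsCross_iff]
      omega
    | left h' | right h' =>
      have h2 := hR' _ _ h'
      obtain ⟨h3, h4⟩ := hRR' _ _ _ _ h h'
      obtain ⟨h5, -⟩ := hRR' _ _ _ _ h' h
      rw [not_arcsCross_iff]
      clear hUU hU hR' hRR'
      omega

/-- If the values of an injective sequence on a window have spread equal to the length of the
window, then they fill an interval. -/
theorem exists_interval_of_spread {b : ℕ → ℕ} {k₁ k₂ : ℕ} (h : k₁ < k₂)
    (hinj : Set.InjOn b (Finset.Icc k₁ k₂))
    (hspread : (Finset.Icc k₁ k₂).sup' (Finset.nonempty_Icc.mpr h.le) b -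
      (Finset.Icc k₁ k₂).inf' (Finset.nonempty_Icc.mpr h.le) b = k₂ - k₁) :
    ∃ m, (∀ k, k₁ ≤ k → k ≤ k₂ → m ≤ b k ∧ b k ≤ m + (k₂ - k₁)) ∧
      ∀ v, m ≤ v → v ≤ m + (k₂ - k₁) → ∃ k, k₁ ≤ k ∧ k ≤ k₂ ∧ b k = v := by
  set m := (Finset.Icc k₁ k₂).inf' (Finset.nonempty_Icc.mpr h.le) b with hm
  have hbd : ∀ k, k₁ ≤ k → k ≤ k₂ → m ≤ b k ∧ b k ≤ m + (k₂ - k₁) := by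
    intro k hk hk'
    have hmem := Finset.mem_Icc.mpr ⟨hk, hk'⟩
    have h1 := Finset.inf'_le b hmem
    have h2 := Finset.le_sup' b hmem
    omega
  refine ⟨m, hbd, fun v hv hv' => ?_⟩
  have himg : (Finset.Icc k₁ k₂).image b = Finset.Icc m (m + (k₂ - k₁)) := by
    apply Finset.eq_of_subset_of_card_le
    · intro x hx
      obtain ⟨k, hk, rfl⟩ := Finset.mem_image.mp hx
      rw [Finset.mem_Icc] at hk ⊢
      exact hbd k hk.1 hk.2
    · rw [Finset.card_image_of_injOn hinj, Nat.card_Icc, Nat.card_Icc]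
      omega
  have hv'' := Finset.mem_Icc.mpr ⟨hv, hv'⟩
  rw [← himg] at hv''
  obtain ⟨k, hk, rfl⟩ := Finset.mem_image.mp hv''
  rw [Finset.mem_Icc] at hk
  exact ⟨k, hk.1, hk.2, rfl⟩

/-- The values on the initial fixed block. -/
def cableInitial : List ℕ := [21, 20, 1, 4, 17, 24, 25, 16, 5, 8, 13, 30, 31, 12, 9]

/-- The values on the final fixed block. -/
def cableFinal : List ℕ := [10, 11, 32, 29, 14, 7, 6, 15, 26, 23, 18, 3, 2, 19, 22]

/-- The upper arcs among the points `1, …, 32`. -/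
def cableUpper : List (ℕ × ℕ) :=
  [(21, 20), (1, 4), (17, 24), (25, 16), (5, 8), (13, 30), (31, 12), (27, 28), (11, 32),
    (29, 14), (7, 6), (15, 26), (23, 18), (3, 2), (19, 22)]

/-- The lower arcs among the points `1, …, 32`. -/
def cableLower : List (ℕ × ℕ) :=
  [(20, 1), (4, 17), (24, 25), (16, 5), (8, 13), (30, 31), (12, 9), (10, 11), (32, 29),
    (14, 7), (6, 15), (26, 23), (18, 3), (2, 19)]

theorem cableInitial_spread : ∀ i < 15, ∀ j < 15, i + 3 ≤ j →
    ∃ k < 15, ∃ l < 15, i ≤ k ∧ k ≤ j ∧ i ≤ l ∧ l ≤ j ∧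
      cableInitial.getD l 0 + (j - i) < cableInitial.getD k 0 := by
  decide +kernel

theorem cableFinal_spread : ∀ i < 15, ∀ j < 15, i + 3 ≤ j →
    ∃ k < 15, ∃ l < 15, i ≤ k ∧ k ≤ j ∧ i ≤ l ∧ l ≤ j ∧
      cableFinal.getD l 0 + (j - i) < cableFinal.getD k 0 := by
  decide +kernel

theorem cableUpper_not_arcsCross :
    ∀ x ∈ cableUpper, ∀ y ∈ cableUpper, ¬ ArcsCross x.1 x.2 y.1 y.2 := by
  simp only [not_arcsCross_iff]
  decide +kernel

theorem cableLower_not_arcsCross :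
    ∀ x ∈ cableLower, ∀ y ∈ cableLower, ¬ ArcsCross x.1 x.2 y.1 y.2 := by
  simp only [not_arcsCross_iff]
  decide +kernel

/-- The points and their values in the cabled sequence: fixed values on the two end blocks and on
the two middle positions, and two copies of the doubled sequence `a`, the second one reversed. -/
structure IsCabling (n : ℕ) (a b : ℕ → ℕ) : Prop where
  init : ∀ t, t < 15 → b (t + 1) = cableInitial.getD t 0
  odd_fst : ∀ j, 1 ≤ j → j ≤ n → j % 2 = 1 → b (15 + j) = 32 + 2 * a j
  even_fst : ∀ j, 1 ≤ j → j ≤ n → j % 2 = 0 → b (15 + j) = 31 + 2 * a j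
  mid : b (16 + n) = 27
  mid' : b (17 + n) = 28
  odd_snd : ∀ i j, 1 ≤ j → j ≤ n → j % 2 = 1 → i + j = 18 + 2 * n → b i = 31 + 2 * a j
  even_snd : ∀ i j, 1 ≤ j → j ≤ n → j % 2 = 0 → i + j = 18 + 2 * n → b i = 32 + 2 * a j
  final : ∀ t, t < 15 → b (18 + 2 * n + t) = cableFinal.getD t 0

namespace IsCabling

variable {n : ℕ} {a b : ℕ → ℕ}

theorem upperArc (hn : n % 2 = 1) (hb : IsCabling n a b) {i : ℕ} (hi : i % 2 = 1)
    (hi' : i < 2 * n + 32) :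
    CableArc cableUpper 9 (a 1)
        (fun o v => ∃ j, Even j ∧ 1 ≤ j ∧ j < n ∧ o = a (j + 1) ∧ v = a j) (b i) (b (i + 1)) ∨
      CableArc cableUpper 9 (a 1)
        (fun o v => ∃ j, Even j ∧ 1 ≤ j ∧ j < n ∧ o = a (j + 1) ∧ v = a j) (b (i + 1)) (b i) := by
  rcases (by omega : i ≤ 14 ∨ i = 15 ∨ (16 ≤ i ∧ i < 15 + n) ∨ i = 16 + n ∨
    (18 + n ≤ i ∧ i < 17 + 2 * n) ∨ i = 17 + 2 * n ∨ 19 + 2 * n ≤ i) with h | h | h | h | h | h | h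
  · left
    obtain ⟨t, rfl⟩ : ∃ t, i = t + 1 := ⟨i - 1, by omega⟩
    rw [hb.init t (by omega), hb.init (t + 1) (by omega)]
    apply CableArc.small
    have : ∀ t < 14, (t + 1) % 2 = 1 →
      (cableInitial.getD t 0, cableInitial.getD (t + 1) 0) ∈ cableUpper := by decide +kernel
    exact this t (by omega) hi
  · left
    subst h
    rw [hb.odd_fst 1 le_rfl (by omega) rfl, hb.init 14 (by omega)]
    exact .outer
  · right
    obtain ⟨j, rfl⟩ : ∃ j, i = 15 + j := ⟨i - 15, by omega⟩
    rw [add_assoc, hb.even_fst j (by omega) (by omega) (by omega),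
      hb.odd_fst (j + 1) (by omega) (by omega) (by omega)]
    exact .left ⟨j, Nat.even_iff.mpr (by omega), by omega, by omega, rfl, rfl⟩
  · left
    subst h
    rw [show 16 + n + 1 = 17 + n by omega, hb.mid, hb.mid']
    exact .small (by decide)
  · left
    obtain ⟨j, hj⟩ : ∃ j, i + (j + 1) = 18 + 2 * n := ⟨17 + 2 * n - i, by omega⟩
    rw [hb.odd_snd i (j + 1) (by omega) (by omega) (by omega) hj,
      hb.even_snd (i + 1) j (by omega) (by omega) (by omega) (by omega)]
    exact .right ⟨j, Nat.even_iff.mpr (by omega), by omega, by omega, rfl, rfl⟩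
  · right
    subst h
    rw [hb.odd_snd (17 + 2 * n) 1 le_rfl (by omega) rfl (by omega),
      show 17 + 2 * n + 1 = 18 + 2 * n + 0 by omega, hb.final 0 (by omega)]
    exact .inner
  · left
    obtain ⟨t, rfl⟩ : ∃ t, i = 18 + 2 * n + t := ⟨i - (18 + 2 * n), by omega⟩
    rw [add_assoc _ t 1, hb.final t (by omega), hb.final (t + 1) (by omega)]
    apply CableArc.small
    have : ∀ t < 14, t % 2 = 1 →
      (cableFinal.getD t 0, cableFinal.getD (t + 1) 0) ∈ cableUpper := by decide +kernel
    exact this t (by omega) (by omega)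

theorem lowerArc (hn : n % 2 = 1) (hb : IsCabling n a b) {i : ℕ} (hi : i % 2 = 0)
    (hpos : 1 ≤ i) (hi' : i < 2 * n + 32) :
    CableArc cableLower 27 (a n)
        (fun o v => ∃ j, Odd j ∧ j < n ∧ o = a j ∧ v = a (j + 1)) (b i) (b (i + 1)) ∨
      CableArc cableLower 27 (a n)
        (fun o v => ∃ j, Odd j ∧ j < n ∧ o = a j ∧ v = a (j + 1)) (b (i + 1)) (b i) := by
  rcases (by omega : i ≤ 14 ∨ (16 ≤ i ∧ i < 15 + n) ∨ i = 15 + n ∨ i = 17 + n ∨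
    (18 + n ≤ i ∧ i < 17 + 2 * n) ∨ 18 + 2 * n ≤ i) with h | h | h | h | h | h
  · left
    obtain ⟨t, rfl⟩ : ∃ t, i = t + 1 := ⟨i - 1, by omega⟩
    rw [hb.init t (by omega), hb.init (t + 1) (by omega)]
    apply CableArc.small
    have : ∀ t < 14, (t + 1) % 2 = 0 →
      (cableInitial.getD t 0, cableInitial.getD (t + 1) 0) ∈ cableLower := by decide +kernel
    exact this t (by omega) hi
  · left
    obtain ⟨j, rfl⟩ : ∃ j, i = 15 + j := ⟨i - 15, by omega⟩
    rw [add_assoc, hb.odd_fst j (by omega) (by omega) (by omega),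
      hb.even_fst (j + 1) (by omega) (by omega) (by omega)]
    exact .left ⟨j, Nat.odd_iff.mpr (by omega), by omega, rfl, rfl⟩
  · right
    subst h
    rw [hb.odd_fst n (by omega) le_rfl hn, show 15 + n + 1 = 16 + n by omega, hb.mid]
    exact .outer
  · left
    subst h
    rw [hb.mid', hb.odd_snd (17 + n + 1) n (by omega) le_rfl hn (by omega)]
    exact .inner
  · right
    obtain ⟨j, hj⟩ : ∃ j, i + (j + 1) = 18 + 2 * n := ⟨17 + 2 * n - i, by omega⟩
    rw [hb.even_snd i (j + 1) (by omega) (by omega) (by omega) hj,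
      hb.odd_snd (i + 1) j (by omega) (by omega) (by omega) (by omega)]
    exact .right ⟨j, Nat.odd_iff.mpr (by omega), by omega, rfl, rfl⟩
  · left
    obtain ⟨t, rfl⟩ : ∃ t, i = 18 + 2 * n + t := ⟨i - (18 + 2 * n), by omega⟩
    rw [add_assoc _ t 1, hb.final t (by omega), hb.final (t + 1) (by omega)]
    apply CableArc.small
    have : ∀ t < 14, t % 2 = 0 →
      (cableFinal.getD t 0, cableFinal.getD (t + 1) 0) ∈ cableLower := by decide +kernel
    exact this t (by omega) (by omega)

/-- Every position of the cabled sequence is fixed, or lies on the first or the second copy of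
the doubled sequence. -/
theorem position_cases (hn : n % 2 = 1) (ha : IsOpenMeandricPerm n a) (hb : IsCabling n a b) {i : ℕ}
    (hi : 1 ≤ i) (hi' : i ≤ 2 * n + 32) :
    (∃ k < 32, b i = (cableInitial ++ [27, 28] ++ cableFinal).getD k 0 ∧
        i = (if k < 15 then k + 1 else if k < 17 then k + 1 + n else k + 1 + 2 * n)) ∨
      (∃ j, 1 ≤ j ∧ j ≤ n ∧ i = 15 + j ∧ 1 ≤ a j ∧ a j ≤ n ∧
        (b i = 32 + 2 * a j ∧ a j % 2 = 1 ∨ b i = 31 + 2 * a j ∧ a j % 2 = 0)) ∨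
      (∃ j, 1 ≤ j ∧ j ≤ n ∧ i + j = 18 + 2 * n ∧ 1 ≤ a j ∧ a j ≤ n ∧
        (b i = 31 + 2 * a j ∧ a j % 2 = 1 ∨ b i = 32 + 2 * a j ∧ a j % 2 = 0)) := by
  obtain ⟨-, hrange, -, hpar, -⟩ := ha
  rcases (by omega : i ≤ 15 ∨ (16 ≤ i ∧ i ≤ 15 + n) ∨ i = 16 + n ∨ i = 17 + n ∨
    (18 + n ≤ i ∧ i ≤ 17 + 2 * n) ∨ 18 + 2 * n ≤ i) with h | h | h | h | h | h
  · left
    obtain ⟨t, rfl⟩ : ∃ t, i = t + 1 := ⟨i - 1, by omega⟩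
    refine ⟨t, by omega, ?_, by rw [if_pos (by omega)]⟩
    rw [hb.init t (by omega)]
    have : ∀ t < 15, cableInitial.getD t 0 =
      (cableInitial ++ [27, 28] ++ cableFinal).getD t 0 := by decide +kernel
    exact this t (by omega)
  · right; left
    obtain ⟨j, rfl⟩ : ∃ j, i = 15 + j := ⟨i - 15, by omega⟩
    have h1 := hrange j (by omega) (by omega)
    have h2 := hpar j (by omega) (by omega)
    have h3 := hb.odd_fst j (by omega) (by omega)
    have h4 := hb.even_fst j (by omega) (by omega)
    refine ⟨j, by omega, by omega, rfl, h1.1, h1.2, ?_⟩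
    rcases Nat.mod_two_eq_zero_or_one j with h5 | h5
    · exact .inr ⟨h4 h5, by omega⟩
    · exact .inl ⟨h3 h5, by omega⟩
  · exact .inl ⟨15, by omega, by rw [h, hb.mid]; rfl, by simp; omega⟩
  · exact .inl ⟨16, by omega, by rw [h, hb.mid']; rfl, by simp; omega⟩
  · right; right
    obtain ⟨j, hj⟩ : ∃ j, i + j = 18 + 2 * n := ⟨18 + 2 * n - i, by omega⟩
    have h1 := hrange j (by omega) (by omega)
    have h2 := hpar j (by omega) (by omega)
    have h3 := hb.odd_snd i j (by omega) (by omega)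
    have h4 := hb.even_snd i j (by omega) (by omega)
    refine ⟨j, by omega, by omega, hj, h1.1, h1.2, ?_⟩
    rcases Nat.mod_two_eq_zero_or_one j with h5 | h5
    · exact .inr ⟨h4 h5 hj, by omega⟩
    · exact .inl ⟨h3 h5 hj, by omega⟩
  · left
    obtain ⟨t, rfl⟩ : ∃ t, i = 18 + 2 * n + t := ⟨i - (18 + 2 * n), by omega⟩
    refine ⟨17 + t, by omega, ?_, by rw [if_neg (by omega), if_neg (by omega)]; omega⟩
    rw [hb.final t (by omega)]
    have : ∀ t < 15, cableFinal.getD t 0 =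
      (cableInitial ++ [27, 28] ++ cableFinal).getD (17 + t) 0 := by decide +kernel
    exact this t (by omega)

theorem fixed_range : ∀ k < 32, 1 ≤ (cableInitial ++ [27, 28] ++ cableFinal).getD k 0 ∧
    (cableInitial ++ [27, 28] ++ cableFinal).getD k 0 ≤ 32 := by decide +kernel

theorem fixed_parity : ∀ k < 32, (cableInitial ++ [27, 28] ++ cableFinal).getD k 0 % 2 =
    (if k < 15 then k + 1 else if k < 17 then k else k + 1) % 2 := by decide +kernel

theorem fixed_injective : ∀ k < 32, ∀ l < 32,
    (cableInitial ++ [27, 28] ++ cableFinal).getD k 0 =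
      (cableInitial ++ [27, 28] ++ cableFinal).getD l 0 → k = l := by decide +kernel

theorem range (hn : n % 2 = 1) (ha : IsOpenMeandricPerm n a) (hb : IsCabling n a b) {i : ℕ}
    (hi : 1 ≤ i) (hi' : i ≤ 2 * n + 32) : 1 ≤ b i ∧ b i ≤ 2 * n + 32 := by
  rcases hb.position_cases hn ha hi hi' with ⟨k, hk, h, -⟩ | ⟨j, h⟩ | ⟨j, h⟩
  · have := fixed_range k hk
    omega
  · omega
  · omega

theorem parity (hn : n % 2 = 1) (ha : IsOpenMeandricPerm n a) (hb : IsCabling n a b) {i : ℕ}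
    (hi : 1 ≤ i) (hi' : i ≤ 2 * n + 32) : b i % 2 = i % 2 := by
  have hpar := ha.2.2.2.1
  rcases hb.position_cases hn ha hi hi' with ⟨k, hk, h, h'⟩ | ⟨j, h⟩ | ⟨j, h⟩
  · have := fixed_parity k hk
    split_ifs at this h' <;> omega
  · have := hpar j (by omega) (by omega)
    omega
  · have := hpar j (by omega) (by omega)
    omega

theorem injective (hn : n % 2 = 1) (ha : IsOpenMeandricPerm n a) (hb : IsCabling n a b)
    {i j : ℕ} (hi : 1 ≤ i) (hi' : i ≤ 2 * n + 32) (hj : 1 ≤ j) (hj' : j ≤ 2 * n + 32)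
    (hij : b i = b j) : i = j := by
  have hinj := ha.2.2.1
  rcases hb.position_cases hn ha hi hi' with ⟨k, hk, h, h'⟩ | ⟨k, h⟩ | ⟨k, h⟩ <;>
    rcases hb.position_cases hn ha hj hj' with ⟨l, hl, g, g'⟩ | ⟨l, g⟩ | ⟨l, g⟩
  · rw [h', g', fixed_injective k hk l hl (by rw [← h, ← g, hij])]
  · have := fixed_range k hk
    omega
  · have := fixed_range k hk
    omega
  · have := fixed_range l hl
    omega
  · have := hinj k l (by omega) (by omega) (by omega) (by omega) (by omega)
    omega
  · omega
  · have := fixed_range l hl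
    omega
  · omega
  · have := hinj k l (by omega) (by omega) (by omega) (by omega) (by omega)
    omega

theorem isOpenMeandricPerm (hn : n % 2 = 1) (ha : IsOpenMeandricPerm n a)
    (hb : IsCabling n a b) : IsOpenMeandricPerm (2 * n + 32) b := by
  have ha' := ha
  obtain ⟨-, hrange, hinj, hpar, hup, hlow, hfirst, hlast⟩ := ha'
  rw [if_neg (by rw [Nat.not_even_iff_odd, Nat.odd_iff]; exact hn)] at hlast
  have hfree : ∀ x, x = 21 ∨ x = 22 → ∀ i, Even i → 1 ≤ i → i < 2 * n + 32 →
      ¬ StrictlyBetween (b i) (b (i + 1)) x := by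
    intro x hx i he h1 h2
    have hsmall : ∀ y ∈ cableLower, ∀ x, x = 21 ∨ x = 22 →
        ¬ (min y.1 y.2 < x ∧ x < max y.1 y.2) := by
      intro y hy x hx
      have : ∀ y ∈ cableLower, ¬ (min y.1 y.2 < 21 ∧ 21 < max y.1 y.2) ∧
        ¬ (min y.1 y.2 < 22 ∧ 22 < max y.1 y.2) := by decide +kernel
      rcases hx with rfl | rfl
      · exact (this y hy).1
      · exact (this y hy).2
    unfold StrictlyBetween
    rcases hb.lowerArc hn (Nat.even_iff.mp he) h1 h2 with h | h <;>
      generalize b i = p at h ⊢ <;> generalize b (i + 1) = q at h ⊢ <;>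
      rcases h with h | _ | _ | _ | _ <;> try omega
    · exact hsmall _ h x hx
    · rw [min_comm, max_comm]
      exact hsmall _ h x hx
  refine ⟨by omega, fun i => hb.range hn ha, fun i j => hb.injective hn ha,
    fun i => hb.parity hn ha, ?_, ?_, ?_, ?_⟩
  · intro i j hi hi' hj hj'
    refine not_arcsCross_of_or (fun p q r s => CableArc.not_arcsCross (by omega) ?_ ?_
      cableUpper_not_arcsCross ?_ ?_) (hb.upperArc hn (Nat.odd_iff.mp hi) hi')
      (hb.upperArc hn (Nat.odd_iff.mp hj) hj')
    · exact hpar 1 le_rfl (by omega)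
    · decide +kernel
    · rintro _ _ ⟨j, hj, h1, h2, rfl, rfl⟩
      have hj' := Nat.even_iff.mp hj
      have e1 := hpar j (by omega) (by omega)
      have e2 := hpar (j + 1) (by omega) (by omega)
      have e3 := hrange j (by omega) (by omega)
      have e4 := hrange (j + 1) (by omega) (by omega)
      refine ⟨e4.1, e3.1, by omega, by omega, fun h => ?_, ?_⟩
      · have := hinj _ _ (by omega) (by omega) le_rfl (by omega) h
        omega
      have := hfirst j hj h1 h2
      rwa [StrictlyBetween, min_comm, max_comm]
    · rintro _ _ _ _ ⟨j, hj, h1, h2, rfl, rfl⟩ ⟨k, hk, h3, h4, rfl, rfl⟩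
      refine ⟨fun H => hlow j k hj h1 h2 hk h3 h4
        (arcsCross_swap_left.mp (arcsCross_swap_right.mp H)), fun h => ?_, fun h => ?_⟩
      · have := hinj _ _ (by omega) (by omega) (by omega) (by omega) h
        rw [show j = k by omega]
      · rw [hinj _ _ h1 h2.le h3 h4.le h]
  · intro i j hi h1 hi' hj h2 hj'
    refine not_arcsCross_of_or (fun p q r s => CableArc.not_arcsCross (by omega) ?_ ?_
      cableLower_not_arcsCross ?_ ?_) (hb.lowerArc hn (Nat.even_iff.mp hi) h1 hi')
      (hb.lowerArc hn (Nat.even_iff.mp hj) h2 hj')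
    · rw [hpar n (by omega) le_rfl, hn]
    · decide +kernel
    · rintro _ _ ⟨j, hj, h2, rfl, rfl⟩
      have hj' := Nat.odd_iff.mp hj
      have e1 := hpar j (by omega) (by omega)
      have e2 := hpar (j + 1) (by omega) (by omega)
      have e3 := hrange j (by omega) (by omega)
      have e4 := hrange (j + 1) (by omega) (by omega)
      exact ⟨e3.1, e4.1, by omega, by omega,
        fun h => h2.ne (hinj _ _ hj.pos h2.le (by omega) le_rfl h), hlast j hj h2⟩
    · rintro _ _ _ _ ⟨j, hj, h2, rfl, rfl⟩ ⟨k, hk, h4, rfl, rfl⟩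
      refine ⟨hup j k hj h2 hk h4, fun h => ?_, fun h => ?_⟩
      · rw [hinj _ _ hj.pos h2.le hk.pos h4.le h]
      · have := hinj _ _ (by omega) (by omega) (by omega) (by omega) h
        rw [show j = k by omega]
  · exact hfree _ (.inl (hb.init 0 (by omega)))
  · rw [if_pos (Nat.even_iff.mpr (by omega))]
    refine hfree _ (.inr ?_)
    rw [show 2 * n + 32 = 18 + 2 * n + 14 by omega]
    exact hb.final 14 (by omega)

theorem isIrreducibleMeander (hn : n % 2 = 1) (ha : IsOpenMeandricPerm n a)
    (hb : IsCabling n a b) : IsIrreducibleMeander (2 * n + 32) b := by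
  rintro ⟨k₁, k₂, hlt, h1, h2, h3, h4, hspread⟩
  obtain ⟨m, hbd, hfill⟩ := exists_interval_of_spread hlt (by
    intro x hx y hy hxy
    simp only [Finset.coe_Icc, Set.mem_Icc] at hx hy
    exact hb.injective hn ha (by omega) (by omega) (by omega) (by omega) hxy) hspread
  have hmem : ∀ i, 1 ≤ i → i ≤ 2 * n + 32 → m ≤ b i → b i ≤ m + (k₂ - k₁) →
      k₁ ≤ i ∧ i ≤ k₂ := by
    intro i hi hi' hm hm'
    obtain ⟨k, hk, hk', h⟩ := hfill _ hm hm'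
    rw [← hb.injective hn ha (by omega) (by omega) hi hi' h]
    exact ⟨hk, hk'⟩
  have hfst : ∀ i, 16 ≤ i → i ≤ 15 + n → 33 ≤ b i ∧ (b i % 4 = 2 ∨ b i % 4 = 3) := by
    intro i hi hi'
    rcases hb.position_cases hn ha (by omega : 1 ≤ i) (by omega) with ⟨k, hk, h, h'⟩ | ⟨j, h⟩ | ⟨j, h⟩
    · split_ifs at h' <;> omega
    · omega
    · omega
  have hsnd : ∀ i, 18 + n ≤ i → i ≤ 17 + 2 * n → 33 ≤ b i ∧ (b i % 4 = 0 ∨ b i % 4 = 1) := by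
    intro i hi hi'
    rcases hb.position_cases hn ha (by omega : 1 ≤ i) (by omega) with ⟨k, hk, h, h'⟩ | ⟨j, h⟩ | ⟨j, h⟩
    · split_ifs at h' <;> omega
    · omega
    · omega
  have hpre : ∀ i, 1 ≤ i → i ≤ 15 → b i ≤ 32 := by
    intro i hi hi'
    rcases hb.position_cases hn ha hi (by omega) with ⟨k, hk, h, h'⟩ | ⟨j, h⟩ | ⟨j, h⟩
    · exact h ▸ (fixed_range k hk).2
    · omega
    · omega
  have hsuf : ∀ i, 18 + 2 * n ≤ i → i ≤ 2 * n + 32 → b i ≤ 32 := by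
    intro i hi hi'
    rcases hb.position_cases hn ha (by omega : 1 ≤ i) (by omega) with ⟨k, hk, h, h'⟩ | ⟨j, h⟩ | ⟨j, h⟩
    · exact h ▸ (fixed_range k hk).2
    · omega
    · omega
  have hmid := hb.mid
  have hmid' := hb.mid'
  by_cases hmix : m ≤ 32 ∧ 33 ≤ m + (k₂ - k₁)
  · obtain ⟨hm, hm'⟩ := hmix
    have e1 : b 1 = 21 := hb.init 0 (by omega)
    have e2 : b (18 + 2 * n) = 10 := hb.final 0 (by omega)
    have e3 : b (20 + 2 * n) = 32 := by
      rw [show 20 + 2 * n = 18 + 2 * n + 2 by omega]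
      exact hb.final 2 (by omega)
    have e4 : b (2 * n + 32) = 22 := by
      rw [show 2 * n + 32 = 18 + 2 * n + 14 by omega]
      exact hb.final 14 (by omega)
    have f3 := hmem (20 + 2 * n) (by omega) (by omega) (by omega) (by omega)
    obtain ⟨k, hk, hk', hk33⟩ := hfill 33 (by omega) hm'
    have hkle : k ≤ 17 + 2 * n := by
      by_contra hcon
      have := hsuf k (by omega) (by omega)
      omega
    have f2 := hbd (18 + 2 * n) (by omega) (by omega)
    have f1 := hmem 1 (by omega) (by omega) (by omega) (by omega)
    have f4 := hmem (2 * n + 32) (by omega) (by omega) (by omega) (by omega)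
    omega
  by_cases hm : m ≤ 32
  · have hsmall : ∀ i, k₁ ≤ i → i ≤ k₂ → b i ≤ 32 := by
      intro i hi hi'
      have := hbd i hi hi'
      omega
    have hk : k₂ ≤ 15 ∨ 18 + 2 * n ≤ k₁ := by
      by_contra! hcon
      rcases (by omega : k₁ ≤ 16 ∨ (16 ≤ k₁ ∧ k₁ ≤ 15 + n) ∨ (16 + n ≤ k₁ ∧ k₁ ≤ 18 + n) ∨
        18 + n ≤ k₁) with h | h | h | h
      · have := hsmall 16 h (by omega)
        have := hfst 16 le_rfl (by omega)
        omega
      · have := hsmall k₁ le_rfl hlt.le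
        have := hfst k₁ h.1 h.2
        omega
      · have := hsmall (18 + n) h.2 (by omega)
        have := hsnd (18 + n) le_rfl (by omega)
        omega
      · have := hsmall k₁ le_rfl hlt.le
        have := hsnd k₁ h (by omega)
        omega
    rcases hk with hk | hk
    · obtain ⟨k, hk15, l, hl15, g1, g2, g3, g4, g⟩ :=
        cableInitial_spread (k₁ - 1) (by omega) (k₂ - 1) (by omega) (by omega)
      rw [← hb.init k hk15, ← hb.init l hl15] at g
      have := hbd (k + 1) (by omega) (by omega)
      have := hbd (l + 1) (by omega) (by omega)
      omega
    · obtain ⟨k, hk15, l, hl15, g1, g2, g3, g4, g⟩ :=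
        cableFinal_spread (k₁ - (18 + 2 * n)) (by omega) (k₂ - (18 + 2 * n)) (by omega) (by omega)
      rw [← hb.final k hk15, ← hb.final l hl15] at g
      have := hbd (18 + 2 * n + k) (by omega) (by omega)
      have := hbd (18 + 2 * n + l) (by omega) (by omega)
      omega
  · have hk : (16 ≤ k₁ ∧ k₂ ≤ 15 + n) ∨ (18 + n ≤ k₁ ∧ k₂ ≤ 17 + 2 * n) := by
      by_contra hcon
      have q1 : ¬ k₁ ≤ 15 := fun h => by
        have := hbd k₁ le_rfl hlt.le
        have := hpre k₁ h1 h
        omega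
      have q2 : ¬ 18 + 2 * n ≤ k₂ := fun h => by
        have := hbd k₂ hlt.le le_rfl
        have := hsuf k₂ h h2
        omega
      have q3 : ¬ (k₁ ≤ 16 + n ∧ 16 + n ≤ k₂) := fun h => by
        have := hbd (16 + n) h.1 h.2
        omega
      have q4 : ¬ (k₁ ≤ 17 + n ∧ 17 + n ≤ k₂) := fun h => by
        have := hbd (17 + n) h.1 h.2
        omega
      omega
    obtain ⟨x, hx, hx', ex⟩ := hfill m le_rfl (by omega)
    obtain ⟨y, hy, hy', ey⟩ := hfill (m + 1) (by omega) (by omega)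
    obtain ⟨z, hz, hz', ez⟩ := hfill (m + 2) (by omega) (by omega)
    rcases hk with hk | hk
    · have := hfst x (by omega) (by omega)
      have := hfst y (by omega) (by omega)
      have := hfst z (by omega) (by omega)
      omega
    · have := hsnd x (by omega) (by omega)
      have := hsnd y (by omega) (by omega)
      have := hsnd z (by omega) (by omega)
      omega

end IsCabling

/-- From an open meandric permutation of odd order `n`, the
described sequence of length `2n + 32` is an irreducible open meandric
permutation of order `2n + 32`. -/
theorem irr_construction_odd_32 (n : ℕ) (hn : Odd n) (a : ℕ → ℕ)
    (ha : IsOpenMeandricPerm n a) (b : ℕ → ℕ)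
    (hb : ∀ i, b i =
      if i ≤ 15 then
        [21, 20, 1, 4, 17, 24, 25, 16, 5, 8, 13, 30, 31, 12, 9].getD (i - 1) 0
      else if i ≤ 15 + n then
        (if Odd (i - 15) then 32 + 2 * a (i - 15) else 32 + 2 * a (i - 15) - 1)
      else if i = 16 + n then 27
      else if i = 17 + n then 28
      else if i ≤ 17 + 2 * n then
        (if Odd (i - (17 + n)) then 32 + 2 * a (n + 1 - (i - (17 + n))) - 1
         else 32 + 2 * a (n + 1 - (i - (17 + n))))
      else
        [10, 11, 32, 29, 14, 7, 6, 15, 26, 23, 18, 3, 2, 19, 22].getD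
          (i - (18 + 2 * n)) 0) :
    IsOpenMeandricPerm (2 * n + 32) b ∧ IsIrreducibleMeander (2 * n + 32) b := by
  have hn' := Nat.odd_iff.mp hn
  have hcab : IsCabling n a b := by
    constructor
    · intro t ht
      rw [hb, if_pos (by omega)]
      rfl
    · intro j h1 h2 h3
      rw [hb, if_neg (by omega), if_pos (by omega), Nat.add_sub_cancel_left,
        if_pos (Nat.odd_iff.mpr h3)]
    · intro j h1 h2 h3
      rw [hb, if_neg (by omega), if_pos (by omega), Nat.add_sub_cancel_left,
        if_neg (by rw [Nat.odd_iff]; omega)]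
      omega
    · rw [hb, if_neg (by omega), if_neg (by omega), if_pos rfl]
    · rw [hb, if_neg (by omega), if_neg (by omega), if_neg (by omega), if_pos rfl]
    · intro i j h1 h2 h3 h4
      rw [hb, if_neg (by omega), if_neg (by omega), if_neg (by omega), if_neg (by omega),
        if_pos (by omega), if_pos (Nat.odd_iff.mpr (by omega)),
        show n + 1 - (i - (17 + n)) = j by omega]
      omega
    · intro i j h1 h2 h3 h4
      rw [hb, if_neg (by omega), if_neg (by omega), if_neg (by omega), if_neg (by omega),
        if_pos (by omega), if_neg (by rw [Nat.odd_iff]; omega),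
        show n + 1 - (i - (17 + n)) = j by omega]
    · intro t ht
      rw [hb, if_neg (by omega), if_neg (by omega), if_neg (by omega), if_neg (by omega),
        if_neg (by omega), Nat.add_sub_cancel_left]
      rfl
  exact ⟨hcab.isOpenMeandricPerm hn' ha, hcab.isIrreducibleMeander hn' ha⟩
end

section
/- Let n be an even positive integer and let (a_1,…,a_n) be an open meandric permutation of order n. Then the sequence of length 2n+32 consisting of (23, 22, 1, 4, 19, 26, 27, 18, 5, 8, 15, 30, 31, 14, 11), followed by the block of length n whose j-th entry (1 ≤ j ≤ n) equals 32+2a_j if j is odd and 32+2a_j−1 if j is even, followed by (10, 9), followed by the block of length n whose j-th entry (1 ≤ j ≤ n) equals 32+2a_{n+1−j} if j is odd and 32+2a_{n+1−j}−1 if j is even, followed by (12, 13, 32, 29, 16, 7, 6, 17, 28, 25, 20, 3, 2, 21, 24), is an irreducible open meandric permutation of order 2n+32. -/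
open Filter

instance (p q x : ℕ) : Decidable (StrictlyBetween p q x) :=
  inferInstanceAs (Decidable (_ ∧ _))

theorem arcsCross_iff {p q r s : ℕ} : ArcsCross p q r s ↔
    StrictlyBetween p q r ∧ ¬ StrictlyBetween p q s ∨
      StrictlyBetween p q s ∧ ¬ StrictlyBetween p q r :=
  Iff.rfl

instance (p q r s : ℕ) : Decidable (ArcsCross p q r s) :=
  decidable_of_iff' _ arcsCross_iff

/-- Doubling a strand turns two noncrossing arcs into pairwise noncrossing pairs of parallel
arcs. -/
theorem not_arcsCross_of_double {p q r s x y z w c : ℕ} (h : ¬ ArcsCross p q r s)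
    (hd : p = r ∧ q = s ∨ p ≠ r ∧ p ≠ s ∧ q ≠ r ∧ q ≠ s)
    (hx : x + 1 = c + 2 * p ∧ y = c + 2 * q ∨ x + 1 = c + 2 * q ∧ y = c + 2 * p)
    (hz : z + 1 = c + 2 * r ∧ w = c + 2 * s ∨ z + 1 = c + 2 * s ∧ w = c + 2 * r) :
    ¬ ArcsCross x y z w := by
  simp only [arcsCross_iff, StrictlyBetween] at *
  obtain ⟨rfl, rfl⟩ | hd := hd
  · omega
  · omega

theorem not_arcsCross_swap {p q r s : ℕ} (h : ¬ ArcsCross q p s r) : ¬ ArcsCross p q r s := by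
  simp only [arcsCross_iff, StrictlyBetween] at *
  omega

/-- The pair of strands joined to the source `s` and to the sink `t` of the inserted meander. -/
def IsConnector (s t x y : ℕ) : Prop :=
  x = 11 ∧ y = 32 + 2 * s ∨ x + 1 = 32 + 2 * t ∧ y = 10 ∨ x = 9 ∧ y = 32 + 2 * t ∨
    x + 1 = 32 + 2 * s ∧ y = 12

theorem IsConnector.not_arcsCross {s t x y z w : ℕ} (hst : s < t) (hs : 1 ≤ s)
    (hx : IsConnector s t x y) (hz : IsConnector s t z w) : ¬ ArcsCross x y z w := by
  simp only [arcsCross_iff, StrictlyBetween]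
  obtain h | h | h | h := hx <;> obtain h' | h' | h' | h' := hz <;> omega

theorem IsConnector.not_arcsCross_double {s t p q x y z w : ℕ} (hp : 1 ≤ p) (hq : 1 ≤ q)
    (hs : ¬ StrictlyBetween p q s) (ht : ¬ StrictlyBetween p q t)
    (hne : p ≠ s ∧ p ≠ t ∧ q ≠ s ∧ q ≠ t) (hx : IsConnector s t x y)
    (hz : z + 1 = 32 + 2 * p ∧ w = 32 + 2 * q ∨ z + 1 = 32 + 2 * q ∧ w = 32 + 2 * p) :
    ¬ ArcsCross x y z w ∧ ¬ ArcsCross z w x y := by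
  simp only [arcsCross_iff, StrictlyBetween] at *
  obtain h | h | h | h := hx <;> obtain h' | h' := hz <;> constructor <;> omega

/-- The entries of the construction that do not depend on the inserted meander. -/
def frameEntry (k : ℕ) : ℕ :=
  [23, 22, 1, 4, 19, 26, 27, 18, 5, 8, 15, 30, 31, 14, 11, 10, 9,
    12, 13, 32, 29, 16, 7, 6, 17, 28, 25, 20, 3, 2, 21, 24].getD (k - 1) 0

theorem frameEntry_bounds : ∀ k < 33, 1 ≤ k →
    1 ≤ frameEntry k ∧ frameEntry k ≤ 32 ∧ frameEntry k % 2 = k % 2 := by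
  decide +kernel

theorem frameEntry_injOn : ∀ k < 33, ∀ l < 33, 1 ≤ k → 1 ≤ l →
    frameEntry k = frameEntry l → k = l := by
  decide +kernel

set_option synthInstance.maxHeartbeats 200000 in
set_option synthInstance.maxSize 1000 in
theorem frameEntry_upper_noncrossing : ∀ k < 32, ∀ l < 32,
    k % 2 = 1 ∧ k ≠ 15 ∧ k ≠ 17 ∧ l % 2 = 1 ∧ l ≠ 15 ∧ l ≠ 17 →
    ¬ ArcsCross (frameEntry k) (frameEntry (k + 1)) (frameEntry l) (frameEntry (l + 1)) := by
  decide +kernel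

theorem frameEntry_upper_sides : ∀ k < 32, k % 2 = 1 ∧ k ≠ 15 ∧ k ≠ 17 →
    (frameEntry k < 9 ∧ frameEntry (k + 1) < 9) ∨
    (12 < frameEntry k ∧ frameEntry k ≤ 32 ∧
      12 < frameEntry (k + 1) ∧ frameEntry (k + 1) ≤ 32) := by
  decide +kernel

theorem frameEntry_lower_noncrossing : ∀ k < 32, ∀ l < 32,
    k % 2 = 0 ∧ 1 ≤ k ∧ l % 2 = 0 ∧ 1 ≤ l →
    ¬ ArcsCross (frameEntry k) (frameEntry (k + 1)) (frameEntry l) (frameEntry (l + 1)) := by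
  decide +kernel

theorem frameEntry_lower_not_enclosing : ∀ k < 32, k % 2 = 0 → 1 ≤ k →
    ¬ StrictlyBetween (frameEntry k) (frameEntry (k + 1)) 23 ∧
    ¬ StrictlyBetween (frameEntry k) (frameEntry (k + 1)) 24 := by
  decide +kernel

/-- Any four consecutive entries of the head span an entry outside the head. -/
theorem frameEntry_head_escape : ∀ k < 13, 1 ≤ k → ∃ l < 33, 18 ≤ l ∧
    ∃ p < 4, ∃ q < 4, frameEntry (k + p) ≤ frameEntry l ∧
      frameEntry l ≤ frameEntry (k + q) := by
  decide +kernel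

/-- Any four consecutive entries of the tail span an entry outside the tail. -/
theorem frameEntry_tail_escape : ∀ k < 30, 18 ≤ k → ∃ l < 16, 1 ≤ l ∧
    ∃ p < 4, ∃ q < 4, frameEntry (k + p) ≤ frameEntry l ∧
      frameEntry l ≤ frameEntry (k + q) := by
  decide +kernel

theorem surjOn_of_bounds_injOn {n : ℕ} {a : ℕ → ℕ}
    (hr : ∀ i, 1 ≤ i → i ≤ n → 1 ≤ a i ∧ a i ≤ n)
    (hi : ∀ i j, 1 ≤ i → i ≤ n → 1 ≤ j → j ≤ n → a i = a j → i = j)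
    {v : ℕ} (h1 : 1 ≤ v) (h2 : v ≤ n) : ∃ i, 1 ≤ i ∧ i ≤ n ∧ a i = v := by
  have hsurj := Finset.surjOn_of_injOn_of_card_le (s := Finset.Icc 1 n) (t := Finset.Icc 1 n) a
    (fun i h => by
      simp only [Finset.coe_Icc, Set.mem_Icc] at h ⊢
      exact hr i h.1 h.2)
    (fun i h j h' e => by
      simp only [Finset.coe_Icc, Set.mem_Icc] at h h'
      exact hi i j h.1 h.2 h'.1 h'.2 e) le_rfl
  obtain ⟨i, h, e⟩ := hsurj (show v ∈ (Finset.Icc 1 n : Set ℕ) by simp [h1, h2])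
  simp only [Finset.coe_Icc, Set.mem_Icc] at h
  exact ⟨i, h.1, h.2, e⟩

/-- In an open meandric permutation of even order the source lies left of the sink. -/
theorem IsOpenMeandricPerm.first_lt_last {n : ℕ} {a : ℕ → ℕ} (hn : Even n)
    (ha : IsOpenMeandricPerm n a) : a 1 < a n := by
  obtain ⟨h1, hr, hi, hp, -, -, hs, -⟩ := ha
  obtain ⟨t, rfl⟩ := hn
  by_contra hcon
  have hlt : a (t + t) < a 1 := by
    have := hi 1 (t + t) le_rfl h1 h1 le_rfl
    omega
  have hcard : ∑ i ∈ Finset.range (t + t), (if a (i + 1) < a 1 then 1 else 0) = a 1 - 1 := by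
    rw [← Finset.card_filter, ← Nat.card_Ico 1 (a 1)]
    refine Finset.card_bij (fun i _ => a (i + 1)) ?_ ?_ ?_
    · intro i h
      simp only [Finset.mem_filter, Finset.mem_range] at h
      simp only [Finset.mem_Ico]
      exact ⟨(hr (i + 1) (by omega) h.1).1, h.2⟩
    · intro i h j h' e
      simp only [Finset.mem_filter, Finset.mem_range] at h h'
      have := hi (i + 1) (j + 1) (by omega) h.1 (by omega) h'.1 e
      omega
    · intro v hv
      simp only [Finset.mem_Ico] at hv
      obtain ⟨i, h, h', e⟩ := surjOn_of_bounds_injOn hr hi hv.1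
        (hv.2.le.trans (hr 1 le_rfl h1).2)
      obtain ⟨i, rfl⟩ := Nat.exists_eq_add_of_le' h
      exact ⟨i, by simpa [e, hv.2] using h', e⟩
  have hpairs : ∀ s, s + 1 ≤ t →
      (∑ i ∈ Finset.range (2 * s + 1), (if a (i + 1) < a 1 then 1 else 0)) % 2 = 0 := by
    intro s
    induction s with
    | zero =>
      intro _
      simp only [Nat.mul_zero, Nat.zero_add, Finset.sum_range_one, lt_irrefl, if_false]
    | succ s ih =>
      intro hst
      have hb := hs (2 * s + 1 + 1) (by rw [Nat.even_iff]; omega) (by omega) (by omega)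
      have n1 := hi (2 * s + 1 + 1) 1 (by omega) (by omega) le_rfl h1
      have n2 := hi (2 * s + 1 + 1 + 1) 1 (by omega) (by omega) le_rfl h1
      have key : a (2 * s + 1 + 1) < a 1 ↔ a (2 * s + 1 + 1 + 1) < a 1 := by
        unfold StrictlyBetween at hb
        omega
      have := ih (by omega)
      rw [show 2 * (s + 1) + 1 = 2 * s + 1 + 1 + 1 by ring,
        Finset.sum_range_succ, Finset.sum_range_succ]
      rw [if_congr key rfl rfl]
      split_ifs <;> omega
  have hlast := hpairs (t - 1) (by omega)
  rw [show t + t = 2 * (t - 1) + 1 + 1 by omega, Finset.sum_range_succ,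
    if_pos (by rwa [show 2 * (t - 1) + 1 + 1 = t + t by omega])] at hcard
  have := hp 1 le_rfl h1
  have := (hr 1 le_rfl h1).1
  omega

/-- A window of positions whose values fill an integer interval contains every position whose
value lies between two values of the window. -/
theorem window_closed {N : ℕ} {b : ℕ → ℕ}
    (hi : ∀ i j, 1 ≤ i → i ≤ N → 1 ≤ j → j ≤ N → b i = b j → i = j)
    {k₁ k₂ : ℕ} (h : k₁ < k₂) (h1 : 1 ≤ k₁) (h2 : k₂ ≤ N)
    (hw : (Finset.Icc k₁ k₂).sup' (Finset.nonempty_Icc.mpr h.le) b -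
      (Finset.Icc k₁ k₂).inf' (Finset.nonempty_Icc.mpr h.le) b = k₂ - k₁)
    {p q r : ℕ} (hp : k₁ ≤ p) (hp' : p ≤ k₂) (hq : k₁ ≤ q) (hq' : q ≤ k₂)
    (hr : 1 ≤ r) (hr' : r ≤ N) (hpr : b p ≤ b r) (hrq : b r ≤ b q) :
    k₁ ≤ r ∧ r ≤ k₂ := by
  have hlo : ∀ i, k₁ ≤ i → i ≤ k₂ →
      (Finset.Icc k₁ k₂).inf' (Finset.nonempty_Icc.mpr h.le) b ≤ b i :=
    fun i hx hy => Finset.inf'_le b (Finset.mem_Icc.mpr ⟨hx, hy⟩)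
  have hhi : ∀ i, k₁ ≤ i → i ≤ k₂ →
      b i ≤ (Finset.Icc k₁ k₂).sup' (Finset.nonempty_Icc.mpr h.le) b :=
    fun i hx hy => Finset.le_sup' b (Finset.mem_Icc.mpr ⟨hx, hy⟩)
  generalize (Finset.Icc k₁ k₂).inf' (Finset.nonempty_Icc.mpr h.le) b = lo at *
  generalize (Finset.Icc k₁ k₂).sup' (Finset.nonempty_Icc.mpr h.le) b = hi' at *
  have hsurj := Finset.surjOn_of_injOn_of_card_le
    (s := Finset.Icc k₁ k₂) (t := Finset.Icc lo hi') b
    (fun i hx => by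
      simp only [Finset.coe_Icc, Set.mem_Icc] at hx ⊢
      exact ⟨hlo i hx.1 hx.2, hhi i hx.1 hx.2⟩)
    (fun i hx j hy e => by
      simp only [Finset.coe_Icc, Set.mem_Icc] at hx hy
      exact hi i j (by omega) (by omega) (by omega) (by omega) e)
    (by simp only [Nat.card_Icc]; omega)
  obtain ⟨i, hx, e⟩ := hsurj (show b r ∈ (Finset.Icc lo hi' : Set ℕ) by
    simp only [Finset.coe_Icc, Set.mem_Icc]
    exact ⟨(hlo p hp hp').trans hpr, hrq.trans (hhi q hq hq')⟩)
  simp only [Finset.coe_Icc, Set.mem_Icc] at hx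
  have := hi i r (by omega) (by omega) hr hr' e
  omega

set_option maxHeartbeats 1000000 in
/-- From an open meandric permutation of even order `n`, the
described sequence of length `2n + 32` is an irreducible open meandric
permutation of order `2n + 32`. -/
theorem irr_construction_even_32 (n : ℕ) (hn : Even n) (hn' : 1 ≤ n) (a : ℕ → ℕ)
    (ha : IsOpenMeandricPerm n a) (b : ℕ → ℕ)
    (hb : ∀ i, b i =
      if i ≤ 15 then
        [23, 22, 1, 4, 19, 26, 27, 18, 5, 8, 15, 30, 31, 14, 11].getD (i - 1) 0
      else if i ≤ 15 + n then
        (if Odd (i - 15) then 32 + 2 * a (i - 15) else 32 + 2 * a (i - 15) - 1)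
      else if i = 16 + n then 10
      else if i = 17 + n then 9
      else if i ≤ 17 + 2 * n then
        (if Odd (i - (17 + n)) then 32 + 2 * a (n + 1 - (i - (17 + n)))
         else 32 + 2 * a (n + 1 - (i - (17 + n))) - 1)
      else
        [12, 13, 32, 29, 16, 7, 6, 17, 28, 25, 20, 3, 2, 21, 24].getD
          (i - (18 + 2 * n)) 0) :
    IsOpenMeandricPerm (2 * n + 32) b ∧ IsIrreducibleMeander (2 * n + 32) b := by
  have hfl := ha.first_lt_last hn
  obtain ⟨-, hr, hi, hp, hup, hlow, hsrc, hsink⟩ := ha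
  rw [if_pos hn] at hsink
  have hn2 : n % 2 = 0 := Nat.even_iff.mp hn
  have hhead : ∀ k, 1 ≤ k → k ≤ 15 → b k = frameEntry k := by
    intro k h h'
    rw [hb k, if_pos h']
    interval_cases k <;> rfl
  have htail : ∀ k, 18 ≤ k → k ≤ 32 → b (k + 2 * n) = frameEntry k := by
    intro k h h'
    rw [hb, if_neg (by omega), if_neg (by omega), if_neg (by omega), if_neg (by omega),
      if_neg (by omega), show k + 2 * n - (18 + 2 * n) = k - 18 by omega]
    interval_cases k <;> rfl
  have hten : b (16 + n) = 10 := by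
    rw [hb, if_neg (by omega), if_neg (by omega), if_pos rfl]
  have hnine : b (17 + n) = 9 := by
    rw [hb, if_neg (by omega), if_neg (by omega), if_neg (by omega), if_pos rfl]
  have hfst : ∀ j, 1 ≤ j → j ≤ n → b (15 + j) + (j + 1) % 2 = 32 + 2 * a j := by
    intro j h h'
    rw [hb, if_neg (by omega), if_pos (by omega), show 15 + j - 15 = j by omega]
    split_ifs with hj
    · rw [Nat.odd_iff] at hj; omega
    · rw [Nat.odd_iff] at hj; omega
  have hsnd : ∀ i j, 1 ≤ j → j ≤ n → i + j = 18 + 2 * n →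
      b i + j % 2 = 32 + 2 * a j := by
    intro i j h h' hij
    rw [hb, if_neg (by omega), if_neg (by omega), if_neg (by omega), if_neg (by omega),
      if_pos (by omega), show n + 1 - (i - (17 + n)) = j by omega]
    split_ifs with hj
    · rw [Nat.odd_iff] at hj; omega
    · rw [Nat.odd_iff] at hj; omega
  have hcases : ∀ i, 1 ≤ i → i ≤ 2 * n + 32 →
      (∃ k, 1 ≤ k ∧ k < 33 ∧ b i = frameEntry k ∧
        (k ≤ 15 ∧ i = k ∨ 16 ≤ k ∧ k ≤ 17 ∧ i = k + n ∨ 18 ≤ k ∧ i = k + 2 * n)) ∨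
      (∃ j, 1 ≤ j ∧ j ≤ n ∧ i = 15 + j ∧ b i + (j + 1) % 2 = 32 + 2 * a j) ∨
      (∃ j, 1 ≤ j ∧ j ≤ n ∧ i + j = 18 + 2 * n ∧ b i + j % 2 = 32 + 2 * a j) := by
    intro i h h'
    by_cases c1 : i ≤ 15
    · exact .inl ⟨i, h, by omega, hhead i h c1, by omega⟩
    by_cases c2 : i ≤ 15 + n
    · refine .inr (.inl ⟨i - 15, by omega, by omega, by omega, ?_⟩)
      have := hfst (i - 15) (by omega) (by omega)
      rwa [show 15 + (i - 15) = i by omega] at this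
    by_cases c3 : i = 16 + n
    · exact .inl ⟨16, by omega, by omega, by rw [c3, hten]; rfl, by omega⟩
    by_cases c4 : i = 17 + n
    · exact .inl ⟨17, by omega, by omega, by rw [c4, hnine]; rfl, by omega⟩
    by_cases c5 : i ≤ 17 + 2 * n
    · exact .inr (.inr ⟨18 + 2 * n - i, by omega, by omega, by omega,
        hsnd i _ (by omega) (by omega) (by omega)⟩)
    · refine .inl ⟨i - 2 * n, by omega, by omega, ?_, by omega⟩
      have := htail (i - 2 * n) (by omega) (by omega)
      rwa [show i - 2 * n + 2 * n = i by omega] at this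
  have hbr : ∀ i, 1 ≤ i → i ≤ 2 * n + 32 → 1 ≤ b i ∧ b i ≤ 2 * n + 32 := by
    intro i h h'
    obtain ⟨k, h1, h2, e, -⟩ | ⟨j, h1, h2, -, e⟩ | ⟨j, h1, h2, -, e⟩ := hcases i h h'
    · have := frameEntry_bounds k h2 h1
      omega
    · have := hr j h1 h2
      omega
    · have := hr j h1 h2
      omega
  have hbp : ∀ i, 1 ≤ i → i ≤ 2 * n + 32 → b i % 2 = i % 2 := by
    intro i h h'
    obtain ⟨k, h1, h2, e, hk⟩ | ⟨j, h1, h2, hj, e⟩ | ⟨j, h1, h2, hj, e⟩ := hcases i h h'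
    · have := frameEntry_bounds k h2 h1
      omega
    · omega
    · omega
  have hbi : ∀ i j, 1 ≤ i → i ≤ 2 * n + 32 → 1 ≤ j → j ≤ 2 * n + 32 → b i = b j → i = j := by
    intro i i' h h' g g' eq
    obtain ⟨k, h1, h2, e, hk⟩ | ⟨j, h1, h2, hj, e⟩ | ⟨j, h1, h2, hj, e⟩ := hcases i h h' <;>
    obtain ⟨k', g1, g2, e', hk'⟩ | ⟨j', g1, g2, hj', e'⟩ | ⟨j', g1, g2, hj', e'⟩ := hcases i' g g'
    · have := frameEntry_injOn k h2 k' g2 h1 g1 (by omega)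
      omega
    · have := frameEntry_bounds k h2 h1
      have := hr j' g1 g2
      omega
    · have := frameEntry_bounds k h2 h1
      have := hr j' g1 g2
      omega
    · have := frameEntry_bounds k' g2 g1
      have := hr j h1 h2
      omega
    · have := hi j j' h1 h2 g1 g2 (by omega)
      omega
    · have := hi j j' h1 h2 g1 g2 (by omega)
      omega
    · have := frameEntry_bounds k' g2 g1
      have := hr j h1 h2
      omega
    · have := hi j j' h1 h2 g1 g2 (by omega)
      omega
    · have := hi j j' h1 h2 g1 g2 (by omega)
      omega
  have hb1 : b 1 = 23 := hhead 1 (by omega) (by omega)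
  have hbN : b (2 * n + 32) = 24 := by
    rw [show 2 * n + 32 = 32 + 2 * n by ring]
    exact htail 32 (by omega) (by omega)
  have hA1 := hfst 1 le_rfl hn'
  have hAn := hfst n hn' le_rfl
  have hBn := hsnd (18 + n) n hn' le_rfl (by omega)
  have hB1 := hsnd (17 + 2 * n) 1 le_rfl hn' (by omega)
  have hb15 : b 15 = 11 := hhead 15 (by omega) (by omega)
  have hb18 : b (18 + 2 * n) = 12 := htail 18 (by omega) (by omega)
  have hupper : ∀ i, Odd i → i < 2 * n + 32 →
      (∃ k < 32, k % 2 = 1 ∧ k ≠ 15 ∧ k ≠ 17 ∧ b i = frameEntry k ∧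
        b (i + 1) = frameEntry (k + 1)) ∨
      IsConnector (a 1) (a n) (b i) (b (i + 1)) ∨
      (∃ m, Even m ∧ 1 ≤ m ∧ m < n ∧
        (b i + 1 = 32 + 2 * a m ∧ b (i + 1) = 32 + 2 * a (m + 1) ∨
          b i + 1 = 32 + 2 * a (m + 1) ∧ b (i + 1) = 32 + 2 * a m)) := by
    intro i ho h
    rw [Nat.odd_iff] at ho
    by_cases c1 : i < 15
    · exact .inl ⟨i, by omega, ho, by omega, by omega, hhead i (by omega) (by omega),
        hhead (i + 1) (by omega) (by omega)⟩
    by_cases c2 : i = 15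
    · subst c2
      exact .inr (.inl (.inl ⟨hb15, by omega⟩))
    by_cases c3 : i < 15 + n
    · have e1 := hfst (i - 15) (by omega) (by omega)
      have e2 := hfst (i - 15 + 1) (by omega) (by omega)
      rw [show 15 + (i - 15) = i by omega] at e1
      rw [show 15 + (i - 15 + 1) = i + 1 by omega] at e2
      exact .inr (.inr ⟨i - 15, by rw [Nat.even_iff]; omega, by omega, by omega, by omega⟩)
    by_cases c4 : i = 15 + n
    · subst c4
      rw [show 15 + n + 1 = 16 + n by ring]
      exact .inr (.inl (.inr (.inl ⟨by omega, hten⟩)))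
    by_cases c5 : i = 17 + n
    · subst c5
      rw [show 17 + n + 1 = 18 + n by ring]
      exact .inr (.inl (.inr (.inr (.inl ⟨hnine, by omega⟩))))
    by_cases c6 : i < 17 + 2 * n
    · have e1 := hsnd i (17 + 2 * n - i + 1) (by omega) (by omega) (by omega)
      have e2 := hsnd (i + 1) (17 + 2 * n - i) (by omega) (by omega) (by omega)
      exact .inr (.inr ⟨17 + 2 * n - i, by rw [Nat.even_iff]; omega, by omega, by omega,
        by omega⟩)
    by_cases c7 : i = 17 + 2 * n
    · subst c7
      rw [show 17 + 2 * n + 1 = 18 + 2 * n by ring]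
      exact .inr (.inl (.inr (.inr (.inr ⟨by omega, hb18⟩))))
    · have e1 := htail (i - 2 * n) (by omega) (by omega)
      have e2 := htail (i - 2 * n + 1) (by omega) (by omega)
      rw [show i - 2 * n + 2 * n = i by omega] at e1
      rw [show i - 2 * n + 1 + 2 * n = i + 1 by omega] at e2
      exact .inl ⟨i - 2 * n, by omega, by omega, by omega, by omega, e1, e2⟩
  have hlower : ∀ i, Even i → 1 ≤ i → i < 2 * n + 32 →
      (∃ k < 32, k % 2 = 0 ∧ 1 ≤ k ∧ b i = frameEntry k ∧ b (i + 1) = frameEntry (k + 1)) ∨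
      (∃ m, Odd m ∧ 1 ≤ m ∧ m < n ∧
        (b i = 32 + 2 * a m ∧ b (i + 1) + 1 = 32 + 2 * a (m + 1) ∨
          b i = 32 + 2 * a (m + 1) ∧ b (i + 1) + 1 = 32 + 2 * a m)) := by
    intro i ho h1 h
    rw [Nat.even_iff] at ho
    by_cases c1 : i < 15
    · exact .inl ⟨i, by omega, ho, h1, hhead i (by omega) (by omega),
        hhead (i + 1) (by omega) (by omega)⟩
    by_cases c3 : i < 15 + n
    · have e1 := hfst (i - 15) (by omega) (by omega)
      have e2 := hfst (i - 15 + 1) (by omega) (by omega)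
      rw [show 15 + (i - 15) = i by omega] at e1
      rw [show 15 + (i - 15 + 1) = i + 1 by omega] at e2
      exact .inr ⟨i - 15, by rw [Nat.odd_iff]; omega, by omega, by omega, by omega⟩
    by_cases c4 : i = 16 + n
    · subst c4
      rw [show 16 + n + 1 = 17 + n by ring, hten, hnine]
      exact .inl ⟨16, by omega, by omega, by omega, rfl, rfl⟩
    by_cases c6 : i < 17 + 2 * n
    · have e1 := hsnd i (17 + 2 * n - i + 1) (by omega) (by omega) (by omega)
      have e2 := hsnd (i + 1) (17 + 2 * n - i) (by omega) (by omega) (by omega)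
      exact .inr ⟨17 + 2 * n - i, by rw [Nat.odd_iff]; omega, by omega, by omega, by omega⟩
    · have e1 := htail (i - 2 * n) (by omega) (by omega)
      have e2 := htail (i - 2 * n + 1) (by omega) (by omega)
      rw [show i - 2 * n + 2 * n = i by omega] at e1
      rw [show i - 2 * n + 1 + 2 * n = i + 1 by omega] at e2
      exact .inl ⟨i - 2 * n, by omega, by omega, by omega, e1, e2⟩
  have hdist : ∀ m m', 1 ≤ m → m < n → 1 ≤ m' → m' < n → m % 2 = m' % 2 →
      a m = a m' ∧ a (m + 1) = a (m' + 1) ∨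
        a m ≠ a m' ∧ a m ≠ a (m' + 1) ∧ a (m + 1) ≠ a m' ∧ a (m + 1) ≠ a (m' + 1) := by
    intro m m' h1 h2 h1' h2' hmm
    have := hp m h1 (by omega)
    have := hp m' h1' (by omega)
    have := hp (m + 1) (by omega) (by omega)
    have := hp (m' + 1) (by omega) (by omega)
    by_cases hc : m = m'
    · subst hc
      omega
    · have := hi m m' h1 (by omega) h1' (by omega)
      have := hi (m + 1) (m' + 1) (by omega) (by omega) (by omega) (by omega)
      omega
  have hexposed : ∀ m, Even m → 1 ≤ m → m < n →
      ¬ StrictlyBetween (a m) (a (m + 1)) (a 1) ∧ ¬ StrictlyBetween (a m) (a (m + 1)) (a n) ∧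
      a m ≠ a 1 ∧ a m ≠ a n ∧ a (m + 1) ≠ a 1 ∧ a (m + 1) ≠ a n := by
    intro m he h1 h2
    refine ⟨hsrc m he h1 h2, hsink m he h1 h2, ?_⟩
    rw [Nat.even_iff] at he
    have := hi m 1 h1 (by omega) le_rfl hn'
    have := hi m n h1 (by omega) hn' le_rfl
    have := hi (m + 1) 1 (by omega) (by omega) le_rfl hn'
    have := hi (m + 1) n (by omega) (by omega) hn' le_rfl
    omega
  have ha1 := hr 1 le_rfl hn'
  have han := hr n hn' le_rfl
  have hends : ∀ x y,
      (IsConnector (a 1) (a n) x y ∨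
      (∃ m, Even m ∧ 1 ≤ m ∧ m < n ∧
        (x + 1 = 32 + 2 * a m ∧ y = 32 + 2 * a (m + 1) ∨
          x + 1 = 32 + 2 * a (m + 1) ∧ y = 32 + 2 * a m))) →
      (9 ≤ x ∧ x ≤ 12 ∨ 33 ≤ x) ∧ (9 ≤ y ∧ y ≤ 12 ∨ 33 ≤ y) := by
    rintro x y ((h | h | h | h) | ⟨m, -, h1, h2, h⟩)
    iterate 4 omega
    have := hr m h1 (by omega)
    have := hr (m + 1) (by omega) (by omega)
    omega
  refine ⟨⟨by omega, hbr, hbi, hbp, ?_, ?_, ?_, ?_⟩, ?_⟩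
  · intro i i' ho h ho' h'
    obtain ⟨k, hk, hk2, k15, k17, e, e'⟩ | hx := hupper i ho h <;>
    obtain ⟨l, hl, hl2, l15, l17, f, f'⟩ | hy := hupper i' ho' h'
    · rw [e, e', f, f']
      exact frameEntry_upper_noncrossing k hk l hl ⟨hk2, k15, k17, hl2, l15, l17⟩
    · have := frameEntry_upper_sides k hk ⟨hk2, k15, k17⟩
      have := hends _ _ hy
      rw [e, e']
      simp only [arcsCross_iff, StrictlyBetween]
      omega
    · have := frameEntry_upper_sides l hl ⟨hl2, l15, l17⟩
      have := hends _ _ hx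
      rw [f, f']
      simp only [arcsCross_iff, StrictlyBetween]
      omega
    · obtain hx | ⟨m, m1, m2, m3, hx⟩ := hx <;>
      obtain hy | ⟨m', m1', m2', m3', hy⟩ := hy
      · exact hx.not_arcsCross hfl ha1.1 hy
      · have he := hexposed m' m1' m2' m3'
        exact (hx.not_arcsCross_double (hr m' m2' m3'.le).1 (hr (m' + 1) (by omega) m3').1
          he.1 he.2.1 he.2.2 hy).1
      · have he := hexposed m m1 m2 m3
        exact (hy.not_arcsCross_double (hr m m2 m3.le).1 (hr (m + 1) (by omega) m3).1
          he.1 he.2.1 he.2.2 hx).2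
      · have := hdist m m' m2 m3 m2' m3' (by rw [Nat.even_iff] at *; omega)
        exact not_arcsCross_of_double (hlow m m' m1 m2 m3 m1' m2' m3') this hx hy
  · intro i i' ho h1 h ho' h1' h'
    obtain ⟨k, hk, hk2, hk1, e, e'⟩ | ⟨m, m1, m2, m3, hm⟩ := hlower i ho h1 h <;>
    obtain ⟨l, hl, hl2, hl1, f, f'⟩ | ⟨m', m1', m2', m3', hm'⟩ := hlower i' ho' h1' h'
    · rw [e, e', f, f']
      exact frameEntry_lower_noncrossing k hk l hl ⟨hk2, hk1, hl2, hl1⟩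
    · have := frameEntry_bounds k (by omega) hk1
      have := frameEntry_bounds (k + 1) (by omega) (by omega)
      have := hr m' m2' (by omega)
      have := hr (m' + 1) (by omega) (by omega)
      rw [e, e']
      simp only [arcsCross_iff, StrictlyBetween]
      omega
    · have := frameEntry_bounds l (by omega) hl1
      have := frameEntry_bounds (l + 1) (by omega) (by omega)
      have := hr m m2 (by omega)
      have := hr (m + 1) (by omega) (by omega)
      rw [f, f']
      simp only [arcsCross_iff, StrictlyBetween]
      omega
    · have := hdist m m' m2 m3 m2' m3' (by rw [Nat.odd_iff] at *; omega)
      exact not_arcsCross_swap (not_arcsCross_of_double (c := 32) (hup m m' m1 m3 m1' m3') this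
        (by omega) (by omega))
  · intro i he h1 h
    rw [hb1]
    obtain ⟨k, hk, hk2, hk1, e, e'⟩ | ⟨m, -, -, -, hm⟩ := hlower i he h1 h
    · rw [e, e']
      exact (frameEntry_lower_not_enclosing k hk hk2 hk1).1
    · unfold StrictlyBetween
      omega
  · rw [if_pos (by rw [Nat.even_iff]; omega)]
    intro i he h1 h
    rw [hbN]
    obtain ⟨k, hk, hk2, hk1, e, e'⟩ | ⟨m, -, -, -, hm⟩ := hlower i he h1 h
    · rw [e, e']
      exact (frameEntry_lower_not_enclosing k hk hk2 hk1).2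
    · unfold StrictlyBetween
      omega
  · rintro ⟨k₁, k₂, hlt, hk1, hk2, hlen, hlen', hw⟩
    have hcl : ∀ p q r : ℕ, k₁ ≤ p → p ≤ k₂ → k₁ ≤ q → q ≤ k₂ → 1 ≤ r → r ≤ 2 * n + 32 →
        b p ≤ b r → b r ≤ b q → k₁ ≤ r ∧ r ≤ k₂ :=
      fun p q r x1 x2 x3 x4 x5 x6 x7 x8 => window_closed hbi hlt hk1 hk2 hw x1 x2 x3 x4 x5 x6 x7 x8
    have hspan : ∀ p q, k₁ ≤ p → p ≤ k₂ → k₁ ≤ q → q ≤ k₂ → b p ≤ 12 → 33 ≤ b q → False := by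
      intro p q x1 x2 x3 x4 x5 x6
      have y1 := hcl p q 1 x1 x2 x3 x4 le_rfl (by omega) (by omega) (by omega)
      have y2 := hcl p q (2 * n + 32) x1 x2 x3 x4 (by omega) le_rfl (by omega) (by omega)
      omega
    have hmid : ∀ j, 1 ≤ j → j + 2 ≤ n → ∃ l u, 1 ≤ l ∧ l ≤ n ∧ a l = u ∧
        (a j < u ∧ u < a (j + 2) ∨ a (j + 2) < u ∧ u < a j) := by
      intro j x1 x2
      have := hi j (j + 2) x1 (by omega) (by omega) x2
      have := hp j x1 (by omega)
      have := hp (j + 2) (by omega) x2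
      have := hr j x1 (by omega)
      have := hr (j + 2) (by omega) x2
      obtain ⟨l, y1, y2, y3⟩ := surjOn_of_bounds_injOn hr hi
        (v := min (a j) (a (j + 2)) + 1) (by omega) (by omega)
      exact ⟨l, _, y1, y2, y3, by omega⟩
    have c1 : ¬ (k₁ ≤ 15 ∧ 16 ≤ k₂) := fun hh =>
      hspan 15 (15 + 1) (by omega) (by omega) (by omega) (by omega) (by omega) (by omega)
    have c2 : ¬ (k₁ ≤ 15 + n ∧ 16 + n ≤ k₂) := fun hh =>
      hspan (16 + n) (15 + n) (by omega) (by omega) (by omega) (by omega) (by omega) (by omega)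
    have c3 : ¬ (k₁ ≤ 17 + n ∧ 18 + n ≤ k₂) := fun hh =>
      hspan (17 + n) (18 + n) (by omega) (by omega) (by omega) (by omega) (by omega) (by omega)
    have c4 : ¬ (k₁ ≤ 17 + 2 * n ∧ 18 + 2 * n ≤ k₂) := fun hh =>
      hspan (18 + 2 * n) (17 + 2 * n) (by omega) (by omega) (by omega) (by omega) (by omega)
        (by omega)
    have hregion : k₂ ≤ 15 ∨ 16 ≤ k₁ ∧ k₂ ≤ 15 + n ∨ 18 + n ≤ k₁ ∧ k₂ ≤ 17 + 2 * n ∨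
        18 + 2 * n ≤ k₁ := by omega
    obtain hc | ⟨hc, hc'⟩ | ⟨hc, hc'⟩ | hc := hregion
    · obtain ⟨l, l1, l2, p, p1, q, q1, e1, e2⟩ := frameEntry_head_escape k₁ (by omega) hk1
      rw [← hhead (k₁ + p) (by omega) (by omega), ← htail l l2 (by omega)] at e1
      rw [← hhead (k₁ + q) (by omega) (by omega), ← htail l l2 (by omega)] at e2
      have := hcl _ _ _ (by omega) (by omega) (by omega) (by omega) (by omega) (by omega) e1 e2
      omega
    · obtain ⟨j, rfl⟩ := Nat.exists_eq_add_of_le (show 15 ≤ k₁ by omega)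
      obtain ⟨l, u, l1, l2, e, hu⟩ := hmid j (by omega) (by omega)
      have x1 := hfst j (by omega) (by omega)
      have x2 := hfst (j + 2) (by omega) (by omega)
      have x3 := hsnd (18 + 2 * n - l) l l1 l2 (by omega)
      obtain hu | hu := hu
      · have := hcl (15 + j) (15 + (j + 2)) (18 + 2 * n - l) (by omega) (by omega) (by omega)
          (by omega) (by omega) (by omega) (by omega) (by omega)
        omega
      · have := hcl (15 + (j + 2)) (15 + j) (18 + 2 * n - l) (by omega) (by omega) (by omega)
          (by omega) (by omega) (by omega) (by omega) (by omega)
        omega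
    · obtain ⟨l, u, l1, l2, e, hu⟩ := hmid (16 + 2 * n - k₁) (by omega) (by omega)
      have x1 := hsnd (k₁ + 2) (16 + 2 * n - k₁) (by omega) (by omega) (by omega)
      have x2 := hsnd k₁ (16 + 2 * n - k₁ + 2) (by omega) (by omega) (by omega)
      have x3 := hfst l l1 l2
      obtain hu | hu := hu
      · have := hcl (k₁ + 2) k₁ (15 + l) (by omega) (by omega) (by omega)
          (by omega) (by omega) (by omega) (by omega) (by omega)
        omega
      · have := hcl k₁ (k₁ + 2) (15 + l) (by omega) (by omega) (by omega)
          (by omega) (by omega) (by omega) (by omega) (by omega)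
        omega
    · obtain ⟨k, rfl⟩ := Nat.exists_eq_add_of_le' (show 2 * n ≤ k₁ by omega)
      obtain ⟨l, l1, l2, p, p1, q, q1, e1, e2⟩ := frameEntry_tail_escape k (by omega) (by omega)
      rw [← htail (k + p) (by omega) (by omega), ← hhead l l2 (by omega)] at e1
      rw [← htail (k + q) (by omega) (by omega), ← hhead l l2 (by omega)] at e2
      have := hcl _ _ _ (by omega) (by omega) (by omega) (by omega) (by omega) (by omega) e1 e2
      omega
end
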